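/- arXiv:2211.13851 — 6 statements merged into one kernel-verified Lean document; each statement's English description precedes it below -/
import Mathlib

section
/- For every t ∈ [0,T] and all real numbers x, I_s, p, y₁, y₂, A', A'', the pair (w̄, Ī_b) = (Γ^w(t,x,p,y₁,A'), Γ^{I_b}(t,y₂,A'')) is the unique pair of reals such that simultaneously (i) w̄ maximizes the function w ↦ H_s(t,x,I_s,w,p,Ī_b,y₁,A') over ℝ, and (ii) Ī_b maximizes the function I_b ↦ H_b(t,x,I_s,w̄,p,I_b,y₂,A'') over ℝ; i.e., it satisfies (i) and (ii), and any pair satisfying (i) and (ii) equals (w̄, Ī_b). -/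
noncomputable section

/-- Seller's Hamiltonian H_s. -/
def Hs (r C0 α βx γp γw γx : ℝ) (βp βw δ : ℝ → ℝ)
    (t x Is w p Ib y1 A : ℝ) : ℝ :=
  y1 * (βp t * p + βw t * w - βx * x + δ t * (Is + Ib))
    + (1/2) * (βp t * p + βw t * w + βx * x + δ t * (Is + Ib)) * A
    + Real.exp (-(r*t)) * ((w - C0) * (α - γp * p - γw * w + γx * x) - Is^2)

/-- Buyer's Hamiltonian H_b. -/
def Hb (r α βx γp γw γx : ℝ) (βp βw δ : ℝ → ℝ)
    (t x Is w p Ib y2 A : ℝ) : ℝ :=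
  y2 * (βp t * p + βw t * w - βx * x + δ t * (Is + Ib))
    + (1/2) * (βp t * p + βw t * w + βx * x + δ t * (Is + Ib)) * A
    + Real.exp (-(r*t)) * ((p - w) * (α - γp * p - γw * w + γx * x) - Ib^2)

/-- Γ^w. -/
def Gw (r C0 α γp γw γx : ℝ) (βw : ℝ → ℝ) (t x p y1 A : ℝ) : ℝ :=
  (Real.exp (r*t) * (βw t * y1 + (1/2) * βw t * A) + α - γp * p + γx * x + C0 * γw) / (2*γw)

/-- Γ^{I_b}. -/
def GIb (r : ℝ) (δ : ℝ → ℝ) (t y2 A : ℝ) : ℝ :=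
  Real.exp (r*t) * δ t * (2*y2 + A) / 4

/-- Γ^{I_s}. -/
def GIs (r : ℝ) (δ : ℝ → ℝ) (t y1 A : ℝ) : ℝ :=
  Real.exp (r*t) * δ t * (2*y1 + A) / 4

def K1 (r γp γw : ℝ) (βw : ℝ → ℝ) (t : ℝ) : ℝ :=
  -(Real.exp (r*t) * γw * βw t) / (γp * (2*γw + γp))

def K2 (r γp γw : ℝ) (βp βw : ℝ → ℝ) (t : ℝ) : ℝ :=
  Real.exp (r*t) * (2*γw * βp t - βw t * γp) / (γp * (2*γw + γp))

def K3 (γp γw γx : ℝ) : ℝ := (γw + γp) * γx / (γp * (2*γw + γp))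

def K4 (C0 α γp γw : ℝ) : ℝ := ((γw + γp) * α - C0 * γw^2) / (γp * (2*γw + γp))

/-- Γ^p. -/
def Gp (r C0 α γp γw γx : ℝ) (βp βw : ℝ → ℝ) (t x y1 y2 A A' : ℝ) : ℝ :=
  K1 r γp γw βw t * y1 + (1/2) * K1 r γp γw βw t * A
    + K2 r γp γw βp βw t * y2 + (1/2) * K2 r γp γw βp βw t * A'
    + K3 γp γw γx * x + K4 C0 α γp γw

def K5 (r γp γw : ℝ) (βw : ℝ → ℝ) (t : ℝ) : ℝ :=
  (Real.exp (r*t) * βw t - γp * K1 r γp γw βw t) / (2*γw)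

def K6 (r γp γw : ℝ) (βp βw : ℝ → ℝ) (t : ℝ) : ℝ :=
  -(γp * K2 r γp γw βp βw t) / (2*γw)

def K7 (γp γw γx : ℝ) : ℝ := (γx - γp * K3 γp γw γx) / (2*γw)

def K8 (C0 α γp γw : ℝ) : ℝ := (α + C0*γw - γp * K4 C0 α γp γw) / (2*γw)

def K9 (r γp γw : ℝ) (βp βw δ : ℝ → ℝ) (t : ℝ) : ℝ :=
  βp t * K1 r γp γw βw t - γp * K1 r γp γw βw t * βw t / (2*γw)
    + Real.exp (r*t) * (βw t)^2 / (2*γw) + Real.exp (r*t) * (δ t)^2 / 2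

def K10 (r γp γw : ℝ) (βp βw δ : ℝ → ℝ) (t : ℝ) : ℝ :=
  βp t * K2 r γp γw βp βw t - γp * K2 r γp γw βp βw t * βw t / (2*γw)
    + Real.exp (r*t) * (δ t)^2 / 2

def K11 (βx γp γw γx : ℝ) (βp βw : ℝ → ℝ) (t : ℝ) : ℝ :=
  βp t * K3 γp γw γx - γp * K3 γp γw γx * βw t / (2*γw) + γx * βw t / (2*γw) - βx

def K12 (C0 α γp γw : ℝ) (βp βw : ℝ → ℝ) (t : ℝ) : ℝ :=
  βp t * K4 C0 α γp γw - γp * K4 C0 α γp γw * βw t / (2*γw) + βw t * (α + C0*γw) / (2*γw)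

def K13 (r γp γw : ℝ) (βw : ℝ → ℝ) (t : ℝ) : ℝ :=
  -(γp * K1 r γp γw βw t) - Real.exp (r*t) * βw t

def K14 (γp γw γx : ℝ) : ℝ := γx - γp * K3 γp γw γx

def K15 (C0 α γp γw : ℝ) : ℝ := α - C0*γw - γp * K4 C0 α γp γw

def K16 (r γp γw : ℝ) (βw : ℝ → ℝ) (t : ℝ) : ℝ :=
  (1 + γp/(2*γw)) * K1 r γp γw βw t - Real.exp (r*t) * βw t / (2*γw)

def K17 (γp γw γx : ℝ) : ℝ := (1 + γp/(2*γw)) * K3 γp γw γx - γx/(2*γw)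

def K18 (C0 α γp γw : ℝ) : ℝ := (1 + γp/(2*γw)) * K4 C0 α γp γw - (α + C0*γw)/(2*γw)


theorem Hs_sq (r C0 α βx γp γw γx : ℝ) (βp βw δ : ℝ → ℝ) (hγw : 0 < γw)
    (t x Is w p Ib y1 A : ℝ) :
    Hs r C0 α βx γp γw γx βp βw δ t x Is w p Ib y1 A
      = Hs r C0 α βx γp γw γx βp βw δ t x Is (Gw r C0 α γp γw γx βw t x p y1 A) p Ib y1 A
        - Real.exp (-(r*t)) * γw * (w - Gw r C0 α γp γw γx βw t x p y1 A)^2 := by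
  have hE : Real.exp (-(r*t)) * Real.exp (r*t) = 1 := by
    rw [← Real.exp_add]; simp
  have hG : 2 * γw * Gw r C0 α γp γw γx βw t x p y1 A
      = Real.exp (r*t) * (βw t * y1 + (1/2) * βw t * A) + α - γp * p + γx * x + C0 * γw := by
    unfold Gw; field_simp
  generalize Gw r C0 α γp γw γx βw t x p y1 A = g at *
  unfold Hs
  linear_combination (-(Real.exp (-(r*t)) * (w - g))) * hG - (w - g) * (βw t * y1 + (1/2) * βw t * A) * hE

theorem Hb_sq (r α βx γp γw γx : ℝ) (βp βw δ : ℝ → ℝ)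
    (t x Is w p Ib y2 A : ℝ) :
    Hb r α βx γp γw γx βp βw δ t x Is w p Ib y2 A
      = Hb r α βx γp γw γx βp βw δ t x Is w p (GIb r δ t y2 A) y2 A
        - Real.exp (-(r*t)) * (Ib - GIb r δ t y2 A)^2 := by
  have hE : Real.exp (-(r*t)) * Real.exp (r*t) = 1 := by
    rw [← Real.exp_add]; simp
  have hG : 2 * GIb r δ t y2 A = Real.exp (r*t) * (δ t * y2 + (1/2) * δ t * A) := by
    unfold GIb; ring
  generalize GIb r δ t y2 A = g at *
  unfold Hb
  linear_combination (-(Real.exp (-(r*t)) * (Ib - g))) * hG - (Ib - g) * (δ t * y2 + (1/2) * δ t * A) * hE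

theorem stmt2
    (T r C0 α βx γp γw γx : ℝ) (βp βw δ : ℝ → ℝ)
    (hT : 0 < T) (hα : 0 < α) (hβx : 0 < βx) (hγp : 0 < γp) (hγw : 0 < γw) (hγx : 0 < γx)
    (hβpc : ContinuousOn βp (Set.Icc 0 T)) (hβwc : ContinuousOn βw (Set.Icc 0 T))
    (hδc : ContinuousOn δ (Set.Icc 0 T))
    (hβpp : ∀ t ∈ Set.Icc (0:ℝ) T, 0 < βp t) (hβwp : ∀ t ∈ Set.Icc (0:ℝ) T, 0 < βw t)
    (hδp : ∀ t ∈ Set.Icc (0:ℝ) T, 0 < δ t) :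
    ∀ t ∈ Set.Icc (0:ℝ) T, ∀ x Is p y1 y2 A A' : ℝ,
      ((∀ w : ℝ,
          Hs r C0 α βx γp γw γx βp βw δ t x Is w p (GIb r δ t y2 A') y1 A
            ≤ Hs r C0 α βx γp γw γx βp βw δ t x Is (Gw r C0 α γp γw γx βw t x p y1 A) p (GIb r δ t y2 A') y1 A)
        ∧ (∀ Ib : ℝ,
          Hb r α βx γp γw γx βp βw δ t x Is (Gw r C0 α γp γw γx βw t x p y1 A) p Ib y2 A'
            ≤ Hb r α βx γp γw γx βp βw δ t x Is (Gw r C0 α γp γw γx βw t x p y1 A) p (GIb r δ t y2 A') y2 A'))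
      ∧ (∀ w Ib : ℝ,
          ((∀ w' : ℝ, Hs r C0 α βx γp γw γx βp βw δ t x Is w' p Ib y1 A ≤ Hs r C0 α βx γp γw γx βp βw δ t x Is w p Ib y1 A)
            ∧ (∀ Ib' : ℝ, Hb r α βx γp γw γx βp βw δ t x Is w p Ib' y2 A' ≤ Hb r α βx γp γw γx βp βw δ t x Is w p Ib y2 A'))
          → w = Gw r C0 α γp γw γx βw t x p y1 A ∧ Ib = GIb r δ t y2 A') := by
  intro t _ x Is p y1 y2 A A'
  have hE := Real.exp_pos (-(r*t))
  refine ⟨⟨fun w => ?_, fun Ib => ?_⟩, fun w Ib h => ⟨?_, ?_⟩⟩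
  · rw [Hs_sq r C0 α βx γp γw γx βp βw δ hγw t x Is w]
    exact sub_le_self _ (by positivity)
  · rw [Hb_sq r α βx γp γw γx βp βw δ t x Is _ p Ib]
    exact sub_le_self _ (by positivity)
  · have h1 := h.1 (Gw r C0 α γp γw γx βw t x p y1 A)
    rw [Hs_sq r C0 α βx γp γw γx βp βw δ hγw t x Is w] at h1
    by_contra hne
    have : w - Gw r C0 α γp γw γx βw t x p y1 A ≠ 0 := sub_ne_zero.mpr hne
    have : 0 < Real.exp (-(r*t)) * γw * (w - Gw r C0 α γp γw γx βw t x p y1 A)^2 := by positivity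
    linarith
  · have h1 := h.2 (GIb r δ t y2 A')
    rw [Hb_sq r α βx γp γw γx βp βw δ t x Is w p Ib] at h1
    by_contra hne
    have : Ib - GIb r δ t y2 A' ≠ 0 := sub_ne_zero.mpr hne
    have : 0 < Real.exp (-(r*t)) * (Ib - GIb r δ t y2 A')^2 := by positivity
    linarith
end
end

section
/- For every t ∈ [0,T] and all real numbers x, I_s, y₁, y₂, A', A'', the function p ↦ H_b(t, x, I_s, Γ^w(t,x,p,y₁,A'), p, Γ^{I_b}(t,y₂,A''), y₂, A'') attains a strict global maximum over ℝ at the point p* = Γ^p(t,x,y₁,y₂,A',A'') = K₁(t)·y₁ + (1/2)·K₁(t)·A' + K₂(t)·y₂ + (1/2)·K₂(t)·A'' + K₃·x + K₄. -/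
noncomputable section

theorem stmt4
    (T r C0 α βx γp γw γx : ℝ) (βp βw δ : ℝ → ℝ)
    (hT : 0 < T) (hα : 0 < α) (hβx : 0 < βx) (hγp : 0 < γp) (hγw : 0 < γw) (hγx : 0 < γx)
    (hβpc : ContinuousOn βp (Set.Icc 0 T)) (hβwc : ContinuousOn βw (Set.Icc 0 T))
    (hδc : ContinuousOn δ (Set.Icc 0 T))
    (hβpp : ∀ t ∈ Set.Icc (0:ℝ) T, 0 < βp t) (hβwp : ∀ t ∈ Set.Icc (0:ℝ) T, 0 < βw t)
    (hδp : ∀ t ∈ Set.Icc (0:ℝ) T, 0 < δ t) :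
    ∀ t ∈ Set.Icc (0:ℝ) T, ∀ x Is y1 y2 A A' : ℝ, ∀ p : ℝ,
      p ≠ Gp r C0 α γp γw γx βp βw t x y1 y2 A A' →
      Hb r α βx γp γw γx βp βw δ t x Is (Gw r C0 α γp γw γx βw t x (Gp r C0 α γp γw γx βp βw t x y1 y2 A A') y1 A) (Gp r C0 α γp γw γx βp βw t x y1 y2 A A')
          (GIb r δ t y2 A') y2 A'
        > Hb r α βx γp γw γx βp βw δ t x Is (Gw r C0 α γp γw γx βw t x p y1 A) p (GIb r δ t y2 A') y2 A' := by
  intro t _ x Is y1 y2 A A' p hp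
  have hE : 0 < Real.exp (r*t) := Real.exp_pos _
  have hq : γp * (2*γw + γp) * Gp r C0 α γp γw γx βp βw t x y1 y2 A A'
      = -(Real.exp (r*t) * γw * βw t) * (y1 + A/2)
        + Real.exp (r*t) * (2*γw * βp t - βw t * γp) * (y2 + A'/2)
        + (γw + γp) * γx * x + ((γw + γp) * α - C0 * γw^2) := by
    have h1 : γp ≠ 0 := hγp.ne'
    have h2 : 2*γw + γp ≠ 0 := by positivity
    unfold Gp K1 K2 K3 K4
    field_simp
    ring
  generalize Gp r C0 α γp γw γx βp βw t x y1 y2 A A' = q at hq hp ⊢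
  have hpos : 0 < (Real.exp (r*t))⁻¹ * (γp * (2*γw + γp)) / (4*γw) * (p - q)^2 := by
    have : 0 < (p - q)^2 := by
      have := sub_ne_zero.mpr hp
      positivity
    positivity
  have key : Hb r α βx γp γw γx βp βw δ t x Is (Gw r C0 α γp γw γx βw t x q y1 A) q
          (GIb r δ t y2 A') y2 A'
        - Hb r α βx γp γw γx βp βw δ t x Is (Gw r C0 α γp γw γx βw t x p y1 A) p
          (GIb r δ t y2 A') y2 A'
        = (Real.exp (r*t))⁻¹ * (γp * (2*γw + γp)) / (4*γw) * (p - q)^2 := by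
    unfold Hb Gw
    rw [Real.exp_neg]
    generalize GIb r δ t y2 A' = I
    generalize Real.exp (r*t) = E at hq hE ⊢
    generalize βp t = bp at hq ⊢
    generalize βw t = bw at hq ⊢
    generalize δ t = d
    have hE' := hE.ne'
    have hw' := hγw.ne'
    have e : E⁻¹ * (2 * (q - p)) / (4*γw) * (-(E * γw * bw) * (y1 + A/2)
        + E * (2*γw * bp - bw * γp) * (y2 + A'/2)
        + (γw + γp) * γx * x + ((γw + γp) * α - C0 * γw^2) - γp * (2*γw + γp) * q) = 0 := by
      rw [hq]; ring
    rw [← sub_eq_zero, ← e, ← sub_eq_zero]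
    field_simp
    ring
  linarith
end
end

section
/- For every t ∈ [0,T] and all real numbers x, y₁, y₂, A', A'', the pair (Ī_s, p̄) = (Γ^{I_s}(t,y₁,A'), Γ^p(t,x,y₁,y₂,A',A'')) is the unique pair of reals such that simultaneously (i) Ī_s maximizes the function I_s ↦ H_s(t, x, I_s, Γ^w(t,x,p̄,y₁,A'), p̄, Γ^{I_b}(t,y₂,A''), y₁, A') over ℝ, and (ii) p̄ maximizes the function p ↦ H_b(t, x, Ī_s, Γ^w(t,x,p,y₁,A'), p, Γ^{I_b}(t,y₂,A''), y₂, A'') over ℝ; i.e., it satisfies (i) and (ii), and any pair satisfying (i) and (ii) equals (Ī_s, p̄). -/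
noncomputable section

theorem Hs_gap (r C0 α βx γp γw γx : ℝ) (βp βw δ : ℝ → ℝ) (t x Is w p Ib y1 A : ℝ) :
    Hs r C0 α βx γp γw γx βp βw δ t x (GIs r δ t y1 A) w p Ib y1 A
      - Hs r C0 α βx γp γw γx βp βw δ t x Is w p Ib y1 A
      = Real.exp (-(r*t)) * (Is - GIs r δ t y1 A)^2 := by
  unfold Hs GIs
  rw [Real.exp_neg]
  have hE := Real.exp_ne_zero (r*t)
  generalize Real.exp (r*t) = E at *
  field_simp
  ring

theorem Hb_gap (r C0 α βx γp γw γx : ℝ) (βp βw δ : ℝ → ℝ) (hγp : 0 < γp) (hγw : 0 < γw)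
    (t x Is p Ib y1 y2 A A' : ℝ) :
    Hb r α βx γp γw γx βp βw δ t x Is
        (Gw r C0 α γp γw γx βw t x (Gp r C0 α γp γw γx βp βw t x y1 y2 A A') y1 A)
        (Gp r C0 α γp γw γx βp βw t x y1 y2 A A') Ib y2 A'
      - Hb r α βx γp γw γx βp βw δ t x Is (Gw r C0 α γp γw γx βw t x p y1 A) p Ib y2 A'
      = Real.exp (-(r*t)) * (γp * (2*γw + γp) / (4*γw))
        * (p - Gp r C0 α γp γw γx βp βw t x y1 y2 A A')^2 := by
  have hE := Real.exp_ne_zero (r*t)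
  have hd : γp * (2*γw + γp) ≠ 0 := by positivity
  have hG : γp * (2*γw + γp) * Gp r C0 α γp γw γx βp βw t x y1 y2 A A'
      = -(Real.exp (r*t) * γw * βw t) * (y1 + A/2)
        + Real.exp (r*t) * (2*γw * βp t - βw t * γp) * (y2 + A'/2)
        + (γw + γp) * γx * x + ((γw + γp) * α - C0 * γw^2) := by
    unfold Gp K1 K2 K3 K4
    have h2 : 2*γw + γp ≠ 0 := by positivity
    field_simp
    ring
  generalize Gp r C0 α γp γw γx βp βw t x y1 y2 A A' = q at *
  unfold Hb Gw
  rw [Real.exp_neg]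
  generalize Real.exp (r*t) = E at *
  field_simp
  linear_combination (-32 * (q - p)) * hG

theorem stmt5
    (T r C0 α βx γp γw γx : ℝ) (βp βw δ : ℝ → ℝ)
    (hT : 0 < T) (hα : 0 < α) (hβx : 0 < βx) (hγp : 0 < γp) (hγw : 0 < γw) (hγx : 0 < γx)
    (hβpc : ContinuousOn βp (Set.Icc 0 T)) (hβwc : ContinuousOn βw (Set.Icc 0 T))
    (hδc : ContinuousOn δ (Set.Icc 0 T))
    (hβpp : ∀ t ∈ Set.Icc (0:ℝ) T, 0 < βp t) (hβwp : ∀ t ∈ Set.Icc (0:ℝ) T, 0 < βw t)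
    (hδp : ∀ t ∈ Set.Icc (0:ℝ) T, 0 < δ t) :
    ∀ t ∈ Set.Icc (0:ℝ) T, ∀ x y1 y2 A A' : ℝ,
      ((∀ Is : ℝ,
          Hs r C0 α βx γp γw γx βp βw δ t x Is (Gw r C0 α γp γw γx βw t x (Gp r C0 α γp γw γx βp βw t x y1 y2 A A') y1 A) (Gp r C0 α γp γw γx βp βw t x y1 y2 A A')
              (GIb r δ t y2 A') y1 A
            ≤ Hs r C0 α βx γp γw γx βp βw δ t x (GIs r δ t y1 A) (Gw r C0 α γp γw γx βw t x (Gp r C0 α γp γw γx βp βw t x y1 y2 A A') y1 A)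
                (Gp r C0 α γp γw γx βp βw t x y1 y2 A A') (GIb r δ t y2 A') y1 A)
        ∧ (∀ p : ℝ,
          Hb r α βx γp γw γx βp βw δ t x (GIs r δ t y1 A) (Gw r C0 α γp γw γx βw t x p y1 A) p (GIb r δ t y2 A') y2 A'
            ≤ Hb r α βx γp γw γx βp βw δ t x (GIs r δ t y1 A) (Gw r C0 α γp γw γx βw t x (Gp r C0 α γp γw γx βp βw t x y1 y2 A A') y1 A)
                (Gp r C0 α γp γw γx βp βw t x y1 y2 A A') (GIb r δ t y2 A') y2 A'))
      ∧ (∀ Is p : ℝ,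
          ((∀ Is' : ℝ,
              Hs r C0 α βx γp γw γx βp βw δ t x Is' (Gw r C0 α γp γw γx βw t x p y1 A) p (GIb r δ t y2 A') y1 A
                ≤ Hs r C0 α βx γp γw γx βp βw δ t x Is (Gw r C0 α γp γw γx βw t x p y1 A) p (GIb r δ t y2 A') y1 A)
            ∧ (∀ p' : ℝ,
              Hb r α βx γp γw γx βp βw δ t x Is (Gw r C0 α γp γw γx βw t x p' y1 A) p' (GIb r δ t y2 A') y2 A'
                ≤ Hb r α βx γp γw γx βp βw δ t x Is (Gw r C0 α γp γw γx βw t x p y1 A) p (GIb r δ t y2 A') y2 A'))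
          → Is = GIs r δ t y1 A ∧ p = Gp r C0 α γp γw γx βp βw t x y1 y2 A A') := by
  intro t ht x y1 y2 A A'
  have he := Real.exp_pos (-(r*t))
  have hc : 0 < Real.exp (-(r*t)) * (γp * (2*γw + γp) / (4*γw)) := by positivity
  refine ⟨⟨fun Is => ?_, fun p => ?_⟩, fun Is p h => ⟨?_, ?_⟩⟩
  · rw [← sub_nonneg, Hs_gap]
    positivity
  · rw [← sub_nonneg, Hb_gap _ _ _ _ _ _ _ _ _ _ hγp hγw]
    positivity
  · have h1 := sub_nonpos.2 (h.1 (GIs r δ t y1 A))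
    rw [Hs_gap] at h1
    have h2 : (Is - GIs r δ t y1 A)^2 ≤ 0 := nonpos_of_mul_nonpos_right h1 he
    exact sub_eq_zero.1 (pow_eq_zero_iff (two_ne_zero)|>.1 (le_antisymm h2 (sq_nonneg _)))
  · have h1 := sub_nonpos.2 (h.2 (Gp r C0 α γp γw γx βp βw t x y1 y2 A A'))
    rw [Hb_gap _ _ _ _ _ _ _ _ _ _ hγp hγw] at h1
    have h2 := nonpos_of_mul_nonpos_right h1 hc
    exact sub_eq_zero.1 (pow_eq_zero_iff (two_ne_zero)|>.1 (le_antisymm h2 (sq_nonneg _)))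
end
end

section
/- Suppose P₂, P₁, P₀, N₂, N₁ : [0,T] → ℝ are differentiable and satisfy for all t ∈ [0,T]: (37) P₂'(t) + 2·P₂·(2·K₉·P₂ + 2·K₁₀·N₂ + K₁₁) + (e^{−rt}/2)·(2·K₅·P₂ + 2·K₆·N₂ + K₇)·(2·K₁₃·P₂ − 2·γ_p·K₂·N₂ + K₁₄) − e^{rt}·δ(t)²·P₂² = 0; (38) P₁'(t) + 2·P₂·(K₉·P₁ + K₁₀·N₁ + K₉·P₂ + K₁₀·N₂ + K₁₂) + P₁·(2·K₉·P₂ + 2·K₁₀·N₂ + K₁₁) + P₂·(2·K₉·P₂ + 2·K₁₀·N₂ + K₁₁ + 2·β_x) + (e^{−rt}/2)·(2·K₅·P₂ + 2·K₆·N₂ + K₇)·(K₁₃·P₁ − γ_p·K₂·N₁ + K₁₃·P₂ − γ_p·K₂·N₂ + K₁₅) + (e^{−rt}/2)·(K₅·P₁ + K₆·N₁ + K₅·P₂ + K₆·N₂ + K₈ − C₀)·(2·K₁₃·P₂ − 2·γ_p·K₂·N₂ + K₁₄) − e^{rt}·δ(t)²·P₂·(P₁+P₂) = 0; (39) P₀'(t)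 + (P₁+P₂)·(K₉·P₁ + K₁₀·N₁ + K₉·P₂ + K₁₀·N₂ + K₁₂) + (e^{−rt}/2)·(K₅·P₁ + K₆·N₁ + K₅·P₂ + K₆·N₂ + K₈ − C₀)·(K₁₃·P₁ − γ_p·K₂·N₁ + K₁₃·P₂ − γ_p·K₂·N₂ + K₁₅) − (e^{rt}·δ(t)²/4)·(P₁+P₂)² = 0 (all K's and P's, N's evaluated at t). Define the feedback maps u₁*(t,x) = Γ^{I_s}(t, 2·P₂(t)·x+P₁(t), 2·P₂(t)), u₂*(t,x) = Γ^p(t, x, 2·P₂(t)·x+P₁(t), 2·N₂(t)·x+N₁(t), 2·P₂(t), 2·N₂(t)), v₁*(t,x) = Γ^w(t, x, u₂*(t,x), 2·P₂(t)·x+P₁(t), 2·P₂(t)), v₂*(t,x) = Γ^{I_b}(t, 2·N₂(t)·x+N₁(t), 2·N₂(t)). Then for all (t,x) ∈ [0,T] × ℝ the seller's HJB identity holds: P₂'(t)·x² + P₁'(t)·x + P₀'(t) + H_s(t, x, u₁*(t,x), v₁*(t,x), u₂*(t,x), v₂*(t,x), 2·P₂(t)·x+P₁(t), 2·P₂(t))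 = 0. -/
noncomputable section

theorem stmt7
    (T r C0 α βx γp γw γx : ℝ) (βp βw δ : ℝ → ℝ)
    (hT : 0 < T) (hα : 0 < α) (hβx : 0 < βx) (hγp : 0 < γp) (hγw : 0 < γw) (hγx : 0 < γx)
    (hβpc : ContinuousOn βp (Set.Icc 0 T)) (hβwc : ContinuousOn βw (Set.Icc 0 T))
    (hδc : ContinuousOn δ (Set.Icc 0 T))
    (hβpp : ∀ t ∈ Set.Icc (0:ℝ) T, 0 < βp t) (hβwp : ∀ t ∈ Set.Icc (0:ℝ) T, 0 < βw t)
    (hδp : ∀ t ∈ Set.Icc (0:ℝ) T, 0 < δ t)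
    (P₂ P₁ P₀ N₂ N₁ dP₂ dP₁ dP₀ : ℝ → ℝ)
    (hP₂ : ∀ t ∈ Set.Icc (0:ℝ) T, HasDerivWithinAt P₂ (dP₂ t) (Set.Icc 0 T) t)
    (hP₁ : ∀ t ∈ Set.Icc (0:ℝ) T, HasDerivWithinAt P₁ (dP₁ t) (Set.Icc 0 T) t)
    (hP₀ : ∀ t ∈ Set.Icc (0:ℝ) T, HasDerivWithinAt P₀ (dP₀ t) (Set.Icc 0 T) t)
    (hN₂ : DifferentiableOn ℝ N₂ (Set.Icc 0 T))
    (hN₁ : DifferentiableOn ℝ N₁ (Set.Icc 0 T))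
    (heq37 : ∀ t ∈ Set.Icc (0:ℝ) T,
        dP₂ t
          + 2 * P₂ t * (2 * K9 r γp γw βp βw δ t * P₂ t + 2 * K10 r γp γw βp βw δ t * N₂ t + K11 βx γp γw γx βp βw t)
          + (Real.exp (-(r*t)) / 2) * (2 * K5 r γp γw βw t * P₂ t + 2 * K6 r γp γw βp βw t * N₂ t + K7 γp γw γx)
              * (2 * K13 r γp γw βw t * P₂ t - 2 * γp * K2 r γp γw βp βw t * N₂ t + K14 γp γw γx)
          - Real.exp (r*t) * (δ t)^2 * (P₂ t)^2 = 0)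
    (heq38 : ∀ t ∈ Set.Icc (0:ℝ) T,
        dP₁ t
          + 2 * P₂ t * (K9 r γp γw βp βw δ t * P₁ t + K10 r γp γw βp βw δ t * N₁ t + K9 r γp γw βp βw δ t * P₂ t + K10 r γp γw βp βw δ t * N₂ t + K12 C0 α γp γw βp βw t)
          + P₁ t * (2 * K9 r γp γw βp βw δ t * P₂ t + 2 * K10 r γp γw βp βw δ t * N₂ t + K11 βx γp γw γx βp βw t)
          + P₂ t * (2 * K9 r γp γw βp βw δ t * P₂ t + 2 * K10 r γp γw βp βw δ t * N₂ t + K11 βx γp γw γx βp βw t + 2 * βx)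
          + (Real.exp (-(r*t)) / 2) * (2 * K5 r γp γw βw t * P₂ t + 2 * K6 r γp γw βp βw t * N₂ t + K7 γp γw γx)
              * (K13 r γp γw βw t * P₁ t - γp * K2 r γp γw βp βw t * N₁ t + K13 r γp γw βw t * P₂ t - γp * K2 r γp γw βp βw t * N₂ t + K15 C0 α γp γw)
          + (Real.exp (-(r*t)) / 2) * (K5 r γp γw βw t * P₁ t + K6 r γp γw βp βw t * N₁ t + K5 r γp γw βw t * P₂ t + K6 r γp γw βp βw t * N₂ t + K8 C0 α γp γw - C0)
              * (2 * K13 r γp γw βw t * P₂ t - 2 * γp * K2 r γp γw βp βw t * N₂ t + K14 γp γw γx)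
          - Real.exp (r*t) * (δ t)^2 * P₂ t * (P₁ t + P₂ t) = 0)
    (heq39 : ∀ t ∈ Set.Icc (0:ℝ) T,
        dP₀ t
          + (P₁ t + P₂ t) * (K9 r γp γw βp βw δ t * P₁ t + K10 r γp γw βp βw δ t * N₁ t + K9 r γp γw βp βw δ t * P₂ t + K10 r γp γw βp βw δ t * N₂ t + K12 C0 α γp γw βp βw t)
          + (Real.exp (-(r*t)) / 2) * (K5 r γp γw βw t * P₁ t + K6 r γp γw βp βw t * N₁ t + K5 r γp γw βw t * P₂ t + K6 r γp γw βp βw t * N₂ t + K8 C0 α γp γw - C0)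
              * (K13 r γp γw βw t * P₁ t - γp * K2 r γp γw βp βw t * N₁ t + K13 r γp γw βw t * P₂ t - γp * K2 r γp γw βp βw t * N₂ t + K15 C0 α γp γw)
          - (Real.exp (r*t) * (δ t)^2 / 4) * (P₁ t + P₂ t)^2 = 0) :
    ∀ t ∈ Set.Icc (0:ℝ) T, ∀ x : ℝ,
      dP₂ t * x^2 + dP₁ t * x + dP₀ t
        + Hs r C0 α βx γp γw γx βp βw δ t x (GIs r δ t (2 * P₂ t * x + P₁ t) (2 * P₂ t)) (Gw r C0 α γp γw γx βw t x (Gp r C0 α γp γw γx βp βw t x (2 * P₂ t * x + P₁ t) (2 * N₂ t * x + N₁ t) (2 * P₂ t) (2 * N₂ t)) (2 * P₂ t * x + P₁ t) (2 * P₂ t)) (Gp r C0 α γp γw γx βp βw t x (2 * P₂ t * x + P₁ t) (2 * N₂ t * x + N₁ t) (2 * P₂ t) (2 * N₂ t)) (GIb r δ t (2 * N₂ t * x + N₁ t) (2 * N₂ t)) (2 * P₂ t * x + P₁ t) (2 * P₂ t) = 0 := by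
  intro t ht x
  have h37 := heq37 t ht
  have h38 := heq38 t ht
  have h39 := heq39 t ht
  clear heq37 heq38 heq39
  have hE : Real.exp (r*t) * Real.exp (-(r*t)) = 1 := by
    rw [← Real.exp_add]; simp
  have hg : γw ≠ 0 := hγw.ne'
  simp only [Hs, GIs, GIb, Gw, Gp, K5, K6, K7, K8, K9, K10, K11, K12, K13, K14, K15]
    at h37 h38 h39 ⊢
  generalize Real.exp (r*t) = E at *
  generalize Real.exp (-(r*t)) = F at *
  generalize K1 r γp γw βw t = k1 at *
  generalize K2 r γp γw βp βw t = k2 at *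
  generalize K3 γp γw γx = k3 at *
  generalize K4 C0 α γp γw = k4 at *
  linear_combination (norm := skip) x^2 * h37 + x * h38 + h39
    - (E * (δ t)^2 * (2 * P₂ t * x + P₁ t + P₂ t)^2 / 4) * hE
  field_simp
  ring
end
end

section
/- Suppose P₂, P₁, N₂, N₁, N₀ : [0,T] → ℝ are differentiable and satisfy for all t ∈ [0,T]: (40) N₂'(t) + 2·N₂·(2·K₉·P₂ + 2·K₁₀·N₂ + K₁₁) + (e^{−rt}/2)·(2·K₁₆·P₂ + 2·(1+γ_p/(2·γ_w))·K₂·N₂ + K₁₇)·(2·K₁₃·P₂ − 2·γ_p·K₂·N₂ + K₁₄) − e^{rt}·δ(t)²·N₂² = 0; (41) N₁'(t) + 2·N₂·(K₉·P₁ + K₁₀·N₁ + K₉·P₂ + K₁₀·N₂ + K₁₂) + N₁·(2·K₉·P₂ + 2·K₁₀·N₂ + K₁₁) + N₂·(2·K₉·P₂ + 2·K₁₀·N₂ + K₁₁ + 2·β_x) + (e^{−rt}/2)·(2·K₁₆·P₂ + 2·(1+γ_p/(2·γ_w))·K₂·N₂ + K₁₇)·(K₁₃·P₁ − γ_p·K₂·N₁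 + K₁₃·P₂ − γ_p·K₂·N₂ + K₁₅) + (e^{−rt}/2)·(K₁₆·P₁ + (1+γ_p/(2·γ_w))·K₂·N₁ + K₁₆·P₂ + (1+γ_p/(2·γ_w))·K₂·N₂ + K₁₈)·(2·K₁₃·P₂ − 2·γ_p·K₂·N₂ + K₁₄) − e^{rt}·δ(t)²·N₂·(N₁+N₂) = 0; (42) N₀'(t) + (N₁+N₂)·(K₉·P₁ + K₁₀·N₁ + K₉·P₂ + K₁₀·N₂ + K₁₂) + (e^{−rt}/2)·(K₁₆·P₁ + (1+γ_p/(2·γ_w))·K₂·N₁ + K₁₆·P₂ + (1+γ_p/(2·γ_w))·K₂·N₂ + K₁₈)·(K₁₃·P₁ − γ_p·K₂·N₁ + K₁₃·P₂ − γ_p·K₂·N₂ + K₁₅) − (e^{rt}·δ(t)²/4)·(N₁+N₂)² = 0 (all K's and P's, N's evaluated at t). Define the feedback maps u₁*(t,x) = Γ^{I_s}(t, 2·P₂(t)·x+P₁(t), 2·P₂(t)), u₂*(t,x) = Γ^p(t, x, 2·P₂(t)·x+P₁(t), 2·N₂(t)·x+N₁(t), 2·P₂(t), 2·N₂(t)),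 v₁*(t,x) = Γ^w(t, x, u₂*(t,x), 2·P₂(t)·x+P₁(t), 2·P₂(t)), v₂*(t,x) = Γ^{I_b}(t, 2·N₂(t)·x+N₁(t), 2·N₂(t)). Then for all (t,x) ∈ [0,T] × ℝ the buyer's HJB identity holds: N₂'(t)·x² + N₁'(t)·x + N₀'(t) + H_b(t, x, u₁*(t,x), v₁*(t,x), u₂*(t,x), v₂*(t,x), 2·N₂(t)·x+N₁(t), 2·N₂(t)) = 0. -/
noncomputable section

theorem stmt8
    (T r C0 α βx γp γw γx : ℝ) (βp βw δ : ℝ → ℝ)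
    (hT : 0 < T) (hα : 0 < α) (hβx : 0 < βx) (hγp : 0 < γp) (hγw : 0 < γw) (hγx : 0 < γx)
    (hβpc : ContinuousOn βp (Set.Icc 0 T)) (hβwc : ContinuousOn βw (Set.Icc 0 T))
    (hδc : ContinuousOn δ (Set.Icc 0 T))
    (hβpp : ∀ t ∈ Set.Icc (0:ℝ) T, 0 < βp t) (hβwp : ∀ t ∈ Set.Icc (0:ℝ) T, 0 < βw t)
    (hδp : ∀ t ∈ Set.Icc (0:ℝ) T, 0 < δ t)
    (P₂ P₁ N₂ N₁ N₀ dN₂ dN₁ dN₀ : ℝ → ℝ)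
    (hN₂ : ∀ t ∈ Set.Icc (0:ℝ) T, HasDerivWithinAt N₂ (dN₂ t) (Set.Icc 0 T) t)
    (hN₁ : ∀ t ∈ Set.Icc (0:ℝ) T, HasDerivWithinAt N₁ (dN₁ t) (Set.Icc 0 T) t)
    (hN₀ : ∀ t ∈ Set.Icc (0:ℝ) T, HasDerivWithinAt N₀ (dN₀ t) (Set.Icc 0 T) t)
    (hP₂ : DifferentiableOn ℝ P₂ (Set.Icc 0 T))
    (hP₁ : DifferentiableOn ℝ P₁ (Set.Icc 0 T))
    (heq40 : ∀ t ∈ Set.Icc (0:ℝ) T,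
        dN₂ t
          + 2 * N₂ t * (2 * K9 r γp γw βp βw δ t * P₂ t + 2 * K10 r γp γw βp βw δ t * N₂ t + K11 βx γp γw γx βp βw t)
          + (Real.exp (-(r*t)) / 2) * (2 * K16 r γp γw βw t * P₂ t + 2 * (1 + γp/(2*γw)) * K2 r γp γw βp βw t * N₂ t + K17 γp γw γx)
              * (2 * K13 r γp γw βw t * P₂ t - 2 * γp * K2 r γp γw βp βw t * N₂ t + K14 γp γw γx)
          - Real.exp (r*t) * (δ t)^2 * (N₂ t)^2 = 0)
    (heq41 : ∀ t ∈ Set.Icc (0:ℝ) T,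
        dN₁ t
          + 2 * N₂ t * (K9 r γp γw βp βw δ t * P₁ t + K10 r γp γw βp βw δ t * N₁ t + K9 r γp γw βp βw δ t * P₂ t + K10 r γp γw βp βw δ t * N₂ t + K12 C0 α γp γw βp βw t)
          + N₁ t * (2 * K9 r γp γw βp βw δ t * P₂ t + 2 * K10 r γp γw βp βw δ t * N₂ t + K11 βx γp γw γx βp βw t)
          + N₂ t * (2 * K9 r γp γw βp βw δ t * P₂ t + 2 * K10 r γp γw βp βw δ t * N₂ t + K11 βx γp γw γx βp βw t + 2 * βx)
          + (Real.exp (-(r*t)) / 2) * (2 * K16 r γp γw βw t * P₂ t + 2 * (1 + γp/(2*γw)) * K2 r γp γw βp βw t * N₂ t + K17 γp γw γx)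
              * (K13 r γp γw βw t * P₁ t - γp * K2 r γp γw βp βw t * N₁ t + K13 r γp γw βw t * P₂ t - γp * K2 r γp γw βp βw t * N₂ t + K15 C0 α γp γw)
          + (Real.exp (-(r*t)) / 2) * (K16 r γp γw βw t * P₁ t + (1 + γp/(2*γw)) * K2 r γp γw βp βw t * N₁ t + K16 r γp γw βw t * P₂ t + (1 + γp/(2*γw)) * K2 r γp γw βp βw t * N₂ t + K18 C0 α γp γw)
              * (2 * K13 r γp γw βw t * P₂ t - 2 * γp * K2 r γp γw βp βw t * N₂ t + K14 γp γw γx)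
          - Real.exp (r*t) * (δ t)^2 * N₂ t * (N₁ t + N₂ t) = 0)
    (heq42 : ∀ t ∈ Set.Icc (0:ℝ) T,
        dN₀ t
          + (N₁ t + N₂ t) * (K9 r γp γw βp βw δ t * P₁ t + K10 r γp γw βp βw δ t * N₁ t + K9 r γp γw βp βw δ t * P₂ t + K10 r γp γw βp βw δ t * N₂ t + K12 C0 α γp γw βp βw t)
          + (Real.exp (-(r*t)) / 2) * (K16 r γp γw βw t * P₁ t + (1 + γp/(2*γw)) * K2 r γp γw βp βw t * N₁ t + K16 r γp γw βw t * P₂ t + (1 + γp/(2*γw)) * K2 r γp γw βp βw t * N₂ t + K18 C0 α γp γw)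
              * (K13 r γp γw βw t * P₁ t - γp * K2 r γp γw βp βw t * N₁ t + K13 r γp γw βw t * P₂ t - γp * K2 r γp γw βp βw t * N₂ t + K15 C0 α γp γw)
          - (Real.exp (r*t) * (δ t)^2 / 4) * (N₁ t + N₂ t)^2 = 0) :
    ∀ t ∈ Set.Icc (0:ℝ) T, ∀ x : ℝ,
      dN₂ t * x^2 + dN₁ t * x + dN₀ t
        + Hb r α βx γp γw γx βp βw δ t x (GIs r δ t (2 * P₂ t * x + P₁ t) (2 * P₂ t)) (Gw r C0 α γp γw γx βw t x (Gp r C0 α γp γw γx βp βw t x (2 * P₂ t * x + P₁ t) (2 * N₂ t * x + N₁ t) (2 * P₂ t) (2 * N₂ t)) (2 * P₂ t * x + P₁ t) (2 * P₂ t)) (Gp r C0 α γp γw γx βp βw t x (2 * P₂ t * x + P₁ t) (2 * N₂ t * x + N₁ t) (2 * P₂ t) (2 * N₂ t)) (GIb r δ t (2 * N₂ t * x + N₁ t) (2 * N₂ t)) (2 * N₂ t * x + N₁ t) (2 * N₂ t) = 0 := by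
  intro t ht x
  have h40 := heq40 t ht
  have h41 := heq41 t ht
  have h42 := heq42 t ht
  have hEF : Real.exp (-(r*t)) * Real.exp (r*t) = 1 := by
    rw [← Real.exp_add]; simp
  have hg : γw * γw⁻¹ = 1 := mul_inv_cancel₀ hγw.ne'
  simp only [Hb, GIs, Gw, GIb, Gp, K9, K10, K11, K12, K13, K14, K15, K16, K17, K18,
    div_eq_mul_inv, mul_inv] at h40 h41 h42 ⊢
  generalize K1 r γp γw βw t = k1 at *
  generalize K2 r γp γw βp βw t = k2 at *
  generalize K3 γp γw γx = k3 at *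
  generalize K4 C0 α γp γw = k4 at *
  generalize Real.exp (-(r*t)) = F at *
  generalize Real.exp (r*t) = E at *
  generalize γw⁻¹ = g at *
  set p := k1 * (2 * P₂ t * x + P₁ t) + k1 * P₂ t + k2 * (2 * N₂ t * x + N₁ t)
    + k2 * N₂ t + k3 * x + k4 with hp
  set n := E * (βw t * (2 * P₂ t * x + P₁ t) + βw t * P₂ t) + α - γp * p + γx * x + C0 * γw
    with hn
  linear_combination x^2 * h40 + x * h41 + h42
    - E * (δ t)^2 * (4 * N₂ t * x + 2 * N₁ t + 2 * N₂ t)^2 / 16 * hEF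
    - F * (p - n * g / 2) * n / 2 * hg
end
end

section
/- There exists η ∈ (0,T] such that on the interval [T−η, T] there is exactly one pair of differentiable functions (P₂, N₂) with terminal values P₂(T) = 0 and N₂(T) = 0 satisfying, for all t ∈ [T−η, T], the coupled Riccati equations: P₂'(t) + 2·P₂·(2·K₉·P₂ + 2·K₁₀·N₂ + K₁₁) + (e^{−rt}/2)·(2·K₅·P₂ + 2·K₆·N₂ + K₇)·(2·K₁₃·P₂ − 2·γ_p·K₂·N₂ + K₁₄) − e^{rt}·δ(t)²·P₂² = 0 and N₂'(t) + 2·N₂·(2·K₉·P₂ + 2·K₁₀·N₂ + K₁₁) + (e^{−rt}/2)·(2·K₁₆·P₂ + 2·(1+γ_p/(2·γ_w))·K₂·N₂ + K₁₇)·(2·K₁₃·P₂ − 2·γ_p·K₂·N₂ + K₁₄) − e^{rt}·δ(t)²·N₂² = 0 (all K's and P₂, N₂ evaluated at t). -/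
noncomputable section

/-- `(P₂, N₂)` is a differentiable solution on `[T-η, T]` of the coupled Riccati system
(37) and (40) with terminal values `P₂ T = 0`, `N₂ T = 0`. -/
def Sol9 (T r C0 α βx γp γw γx : ℝ) (βp βw δ : ℝ → ℝ) (η : ℝ) (P₂ N₂ : ℝ → ℝ) : Prop :=
  P₂ T = 0 ∧ N₂ T = 0 ∧
  ∃ dP₂ dN₂ : ℝ → ℝ,
    ∀ t ∈ Set.Icc (T - η) T,
      HasDerivWithinAt P₂ (dP₂ t) (Set.Icc (T - η) T) t ∧
      HasDerivWithinAt N₂ (dN₂ t) (Set.Icc (T - η) T) t ∧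
      (dP₂ t
          + 2 * P₂ t * (2 * K9 r γp γw βp βw δ t * P₂ t + 2 * K10 r γp γw βp βw δ t * N₂ t + K11 βx γp γw γx βp βw t)
          + (Real.exp (-(r*t)) / 2) * (2 * K5 r γp γw βw t * P₂ t + 2 * K6 r γp γw βp βw t * N₂ t + K7 γp γw γx)
              * (2 * K13 r γp γw βw t * P₂ t - 2 * γp * K2 r γp γw βp βw t * N₂ t + K14 γp γw γx)
          - Real.exp (r*t) * (δ t)^2 * (P₂ t)^2 = 0) ∧
      (dN₂ t
          + 2 * N₂ t * (2 * K9 r γp γw βp βw δ t * P₂ t + 2 * K10 r γp γw βp βw δ t * N₂ t + K11 βx γp γw γx βp βw t)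
          + (Real.exp (-(r*t)) / 2) * (2 * K16 r γp γw βw t * P₂ t + 2 * (1 + γp/(2*γw)) * K2 r γp γw βp βw t * N₂ t + K17 γp γw γx)
              * (2 * K13 r γp γw βw t * P₂ t - 2 * γp * K2 r γp γw βp βw t * N₂ t + K14 γp γw γx)
          - Real.exp (r*t) * (δ t)^2 * (N₂ t)^2 = 0)

/-- Quadratic polynomial in two variables with coefficients `c`. -/
def qd (c : Fin 6 → ℝ) (x y : ℝ) : ℝ :=
  c 0 + c 1 * x + c 2 * y + c 3 * x ^ 2 + c 4 * (x * y) + c 5 * y ^ 2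

theorem qd_bound (c : Fin 6 → ℝ) (M : ℝ) (hc : ∀ i, |c i| ≤ M) (x y : ℝ)
    (hx : |x| ≤ 1) (hy : |y| ≤ 1) : |qd c x y| ≤ 6 * M := by
  have key : ∀ i (z : ℝ), |z| ≤ 1 → |c i * z| ≤ M := by
    intro i z hz
    rw [abs_mul]
    nlinarith [hc i, abs_nonneg (c i), abs_nonneg z]
  have hx2 : |x ^ 2| ≤ 1 := by rw [abs_pow]; exact pow_le_one₀ (abs_nonneg _) hx
  have hy2 : |y ^ 2| ≤ 1 := by rw [abs_pow]; exact pow_le_one₀ (abs_nonneg _) hy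
  have hxy : |x * y| ≤ 1 := by
    rw [abs_mul]; exact mul_le_one₀ hx (abs_nonneg _) hy
  have h0 := abs_le.1 (hc 0)
  have h1 := abs_le.1 (key 1 x hx)
  have h2 := abs_le.1 (key 2 y hy)
  have h3 := abs_le.1 (key 3 _ hx2)
  have h4 := abs_le.1 (key 4 _ hxy)
  have h5 := abs_le.1 (key 5 _ hy2)
  unfold qd
  rw [abs_le]
  constructor <;> linarith

theorem qd_lip (c : Fin 6 → ℝ) (M R d : ℝ) (hc : ∀ i, |c i| ≤ M) (x y x' y' : ℝ)
    (hx : |x| ≤ R) (hy : |y| ≤ R) (hx' : |x'| ≤ R) (hy' : |y'| ≤ R)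
    (hdx : |x - x'| ≤ d) (hdy : |y - y'| ≤ d) :
    |qd c x y - qd c x' y'| ≤ M * (2 + 6 * R) * d := by
  have hd : 0 ≤ d := (abs_nonneg _).trans hdx
  have hR : 0 ≤ R := (abs_nonneg _).trans hx
  have hM : 0 ≤ M := (abs_nonneg _).trans (hc 0)
  have key : ∀ i (z w B : ℝ), |z| ≤ B → |w| ≤ d → |c i * (z * w)| ≤ M * (B * d) := by
    intro i z w B hz hw
    rw [abs_mul, abs_mul]
    have hB : 0 ≤ B := (abs_nonneg _).trans hz
    have := hc i
    gcongr
  have hxx : |x + x'| ≤ 2 * R := (abs_add_le _ _).trans (by linarith)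
  have hyy : |y + y'| ≤ 2 * R := (abs_add_le _ _).trans (by linarith)
  have h1 := abs_le.1 (key 1 1 _ 1 (by simp) hdx)
  have h2 := abs_le.1 (key 2 1 _ 1 (by simp) hdy)
  have h3 := abs_le.1 (key 3 _ _ _ hxx hdx)
  have h4 := abs_le.1 (key 4 _ _ _ hx hdy)
  have h4' := abs_le.1 (key 4 _ _ _ hy' hdx)
  have h5 := abs_le.1 (key 5 _ _ _ hyy hdy)
  unfold qd
  rw [abs_le]
  constructor <;> linarith

/-- The planar quadratic vector field. -/
def vf (a b : Fin 6 → ℝ → ℝ) (t : ℝ) (z : ℝ × ℝ) : ℝ × ℝ :=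
  (qd (fun i => a i t) z.1 z.2, qd (fun i => b i t) z.1 z.2)

theorem mem_ball_prod (z : ℝ × ℝ) (R : ℝ) (hz : z ∈ Metric.closedBall (0 : ℝ × ℝ) R) :
    |z.1| ≤ R ∧ |z.2| ≤ R := by
  rw [mem_closedBall_zero_iff] at hz
  exact ⟨(norm_fst_le z).trans hz, (norm_snd_le z).trans hz⟩

theorem vf_lip (a b : Fin 6 → ℝ → ℝ) (t M R : ℝ) (hM : 0 ≤ M) (hR : 0 ≤ R)
    (ha : ∀ i, |a i t| ≤ M) (hb : ∀ i, |b i t| ≤ M) :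
    LipschitzOnWith (Real.toNNReal (M * (2 + 6 * R))) (vf a b t)
      (Metric.closedBall (0 : ℝ × ℝ) R) := by
  apply LipschitzOnWith.of_dist_le_mul
  intro z hz w hw
  obtain ⟨hz1, hz2⟩ := mem_ball_prod z R hz
  obtain ⟨hw1, hw2⟩ := mem_ball_prod w R hw
  rw [Real.coe_toNNReal _ (by positivity), dist_eq_norm, dist_eq_norm]
  have h1 : |z.1 - w.1| ≤ ‖z - w‖ := norm_fst_le (z - w)
  have h2 : |z.2 - w.2| ≤ ‖z - w‖ := norm_snd_le (z - w)
  rw [Prod.norm_def]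
  exact max_le (qd_lip _ M R _ ha _ _ _ _ hz1 hz2 hw1 hw2 h1 h2)
    (qd_lip _ M R _ hb _ _ _ _ hz1 hz2 hw1 hw2 h1 h2)

theorem coeff_bound (T : ℝ) (a : Fin 6 → ℝ → ℝ)
    (ha : ∀ i, ContinuousOn (a i) (Set.Icc 0 T)) :
    ∃ M : ℝ, 0 ≤ M ∧ ∀ t ∈ Set.Icc 0 T, ∀ i, |a i t| ≤ M := by
  have h : ∀ i, ∃ C, ∀ t ∈ Set.Icc 0 T, ‖a i t‖ ≤ C := fun i =>
    isCompact_Icc.exists_bound_of_continuousOn (ha i)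
  choose C hC using h
  refine ⟨∑ i, |C i|, by positivity, fun t ht i => ?_⟩
  exact ((hC i t ht).trans (le_abs_self _)).trans
    (Finset.single_le_sum (f := fun i => |C i|) (fun j _ => abs_nonneg _) (Finset.mem_univ i))

theorem quad_ode (T : ℝ) (hT : 0 < T) (a b : Fin 6 → ℝ → ℝ)
    (ha : ∀ i, ContinuousOn (a i) (Set.Icc 0 T))
    (hb : ∀ i, ContinuousOn (b i) (Set.Icc 0 T)) :
    ∃ η : ℝ, 0 < η ∧ η ≤ T ∧
      (∃ z : ℝ → ℝ × ℝ, z T = 0 ∧ ∀ t ∈ Set.Icc (T - η) T,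
        HasDerivWithinAt z (vf a b t (z t)) (Set.Icc (T - η) T) t) ∧
      (∀ z w : ℝ → ℝ × ℝ, z T = 0 → w T = 0 →
        (∀ t ∈ Set.Icc (T - η) T,
          HasDerivWithinAt z (vf a b t (z t)) (Set.Icc (T - η) T) t) →
        (∀ t ∈ Set.Icc (T - η) T,
          HasDerivWithinAt w (vf a b t (w t)) (Set.Icc (T - η) T) t) →
        ∀ t ∈ Set.Icc (T - η) T, z t = w t) := by
  obtain ⟨M₁, hM₁, hA⟩ := coeff_bound T a ha
  obtain ⟨M₂, hM₂, hB⟩ := coeff_bound T b hb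
  obtain ⟨M, hM, hAM, hBM⟩ : ∃ M : ℝ, 0 ≤ M ∧ (∀ t ∈ Set.Icc 0 T, ∀ i, |a i t| ≤ M) ∧
      (∀ t ∈ Set.Icc 0 T, ∀ i, |b i t| ≤ M) :=
    ⟨max M₁ M₂, le_max_of_le_left hM₁, fun t ht i => (hA t ht i).trans (le_max_left _ _),
      fun t ht i => (hB t ht i).trans (le_max_right _ _)⟩
  set η : ℝ := min T (1 / (6 * M + 1)) with hη
  have hη0 : 0 < η := lt_min hT (by positivity)
  have hηT : η ≤ T := min_le_left _ _
  have hηM : 6 * M * η ≤ 1 := by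
    have h1 : η ≤ 1 / (6 * M + 1) := min_le_right _ _
    rw [le_div_iff₀ (by positivity)] at h1
    linarith
  have hsub : Set.Icc (T - η) T ⊆ Set.Icc 0 T := Set.Icc_subset_Icc (by linarith) le_rfl
  refine ⟨η, hη0, hηT, ?_, ?_⟩
  · have hT' : T ∈ Set.Icc (T - η) T := ⟨by linarith, le_rfl⟩
    have hPL : IsPicardLindelof (vf a b) (⟨T, hT'⟩ : Set.Icc (T - η) T) (0 : ℝ × ℝ) 1 0
        (Real.toNNReal (6 * M)) (Real.toNNReal (M * (2 + 6 * 1))) := by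
      constructor
      · intro t ht
        exact vf_lip a b t M 1 hM zero_le_one (hAM t (hsub ht)) (hBM t (hsub ht))
      · intro x _
        have hA' : ∀ i, ContinuousOn (a i) (Set.Icc (T - η) T) := fun i => (ha i).mono hsub
        have hB' : ∀ i, ContinuousOn (b i) (Set.Icc (T - η) T) := fun i => (hb i).mono hsub
        unfold vf qd
        fun_prop
      · intro t ht x hx
        obtain ⟨h1, h2⟩ := mem_ball_prod x 1 hx
        rw [Real.coe_toNNReal _ (by positivity), Prod.norm_def]
        exact max_le (qd_bound _ M (hAM t (hsub ht)) _ _ h1 h2)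
          (qd_bound _ M (hBM t (hsub ht)) _ _ h1 h2)
      · rw [Real.coe_toNNReal _ (by positivity)]
        have : max (T - T) (T - (T - η)) = η := by
          rw [max_eq_right] <;> linarith
        simp only [this]
        simpa using hηM
    obtain ⟨z, hz0, hz⟩ := hPL.exists_eq_forall_mem_Icc_hasDerivWithinAt₀
    exact ⟨z, hz0, hz⟩
  · intro z w hz0 hw0 hz hw t ht
    have hzc : ContinuousOn z (Set.Icc (T - η) T) := fun t ht => (hz t ht).continuousWithinAt
    have hwc : ContinuousOn w (Set.Icc (T - η) T) := fun t ht => (hw t ht).continuousWithinAt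
    obtain ⟨C, hC⟩ := isCompact_Icc.exists_bound_of_continuousOn hzc
    obtain ⟨D, hD⟩ := isCompact_Icc.exists_bound_of_continuousOn hwc
    have hR : 0 ≤ max |C| |D| := le_max_of_le_left (abs_nonneg _)
    have hnb : ∀ t ∈ Set.Ioc (T - η) T, Set.Icc (T - η) T ∈ nhdsWithin t (Set.Iic t) :=
      fun t ht => Icc_mem_nhdsLE_of_mem ht
    refine ODE_solution_unique_of_mem_Icc_left (v := vf a b)
      (s := fun _ => Metric.closedBall (0 : ℝ × ℝ) (max |C| |D|))
      (fun t ht => vf_lip a b t M _ hM hR (hAM t (hsub (Set.Ioc_subset_Icc_self ht)))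
        (hBM t (hsub (Set.Ioc_subset_Icc_self ht))))
      hzc (fun t ht => (hz t (Set.Ioc_subset_Icc_self ht)).mono_of_mem_nhdsWithin (hnb t ht)) ?_
      hwc (fun t ht => (hw t (Set.Ioc_subset_Icc_self ht)).mono_of_mem_nhdsWithin (hnb t ht)) ?_
      (hz0.trans hw0.symm) ht
    · intro t ht
      rw [mem_closedBall_zero_iff]
      exact ((hC t (Set.Ioc_subset_Icc_self ht)).trans (le_abs_self _)).trans (le_max_left _ _)
    · intro t ht
      rw [mem_closedBall_zero_iff]
      exact ((hD t (Set.Ioc_subset_Icc_self ht)).trans (le_abs_self _)).trans (le_max_right _ _)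

theorem stmt9
    (T r C0 α βx γp γw γx : ℝ) (βp βw δ : ℝ → ℝ)
    (hT : 0 < T) (hα : 0 < α) (hβx : 0 < βx) (hγp : 0 < γp) (hγw : 0 < γw) (hγx : 0 < γx)
    (hβpc : ContinuousOn βp (Set.Icc 0 T)) (hβwc : ContinuousOn βw (Set.Icc 0 T))
    (hδc : ContinuousOn δ (Set.Icc 0 T))
    (hβpp : ∀ t ∈ Set.Icc (0:ℝ) T, 0 < βp t) (hβwp : ∀ t ∈ Set.Icc (0:ℝ) T, 0 < βw t)
    (hδp : ∀ t ∈ Set.Icc (0:ℝ) T, 0 < δ t) :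
    ∃ η : ℝ, 0 < η ∧ η ≤ T ∧
      (∃ P₂ N₂ : ℝ → ℝ, Sol9 T r C0 α βx γp γw γx βp βw δ η P₂ N₂) ∧
      (∀ P₂ N₂ Q₂ M₂ : ℝ → ℝ,
        Sol9 T r C0 α βx γp γw γx βp βw δ η P₂ N₂ →
        Sol9 T r C0 α βx γp γw γx βp βw δ η Q₂ M₂ →
        ∀ t ∈ Set.Icc (T - η) T, P₂ t = Q₂ t ∧ N₂ t = M₂ t) := by
  have c2 : ContinuousOn (K2 r γp γw βp βw) (Set.Icc 0 T) := by
    unfold K2; fun_prop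
  have c1 : ContinuousOn (K1 r γp γw βw) (Set.Icc 0 T) := by
    unfold K1; fun_prop
  have c5 : ContinuousOn (K5 r γp γw βw) (Set.Icc 0 T) := by
    unfold K5; fun_prop
  have c6 : ContinuousOn (K6 r γp γw βp βw) (Set.Icc 0 T) := by
    unfold K6; fun_prop
  have c9 : ContinuousOn (K9 r γp γw βp βw δ) (Set.Icc 0 T) := by
    unfold K9; fun_prop
  have c10 : ContinuousOn (K10 r γp γw βp βw δ) (Set.Icc 0 T) := by
    unfold K10; fun_prop
  have c11 : ContinuousOn (K11 βx γp γw γx βp βw) (Set.Icc 0 T) := by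
    unfold K11; fun_prop
  have c13 : ContinuousOn (K13 r γp γw βw) (Set.Icc 0 T) := by
    unfold K13; fun_prop
  have c16 : ContinuousOn (K16 r γp γw βw) (Set.Icc 0 T) := by
    unfold K16; fun_prop
  obtain ⟨k2, hk2⟩ : ∃ f, f = K2 r γp γw βp βw := ⟨_, rfl⟩
  obtain ⟨k5, hk5⟩ : ∃ f, f = K5 r γp γw βw := ⟨_, rfl⟩
  obtain ⟨k6, hk6⟩ : ∃ f, f = K6 r γp γw βp βw := ⟨_, rfl⟩
  obtain ⟨k9, hk9⟩ : ∃ f, f = K9 r γp γw βp βw δ := ⟨_, rfl⟩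
  obtain ⟨k10, hk10⟩ : ∃ f, f = K10 r γp γw βp βw δ := ⟨_, rfl⟩
  obtain ⟨k11, hk11⟩ : ∃ f, f = K11 βx γp γw γx βp βw := ⟨_, rfl⟩
  obtain ⟨k13, hk13⟩ : ∃ f, f = K13 r γp γw βw := ⟨_, rfl⟩
  obtain ⟨k16, hk16⟩ : ∃ f, f = K16 r γp γw βw := ⟨_, rfl⟩
  obtain ⟨k7, hk7⟩ : ∃ f, f = K7 γp γw γx := ⟨_, rfl⟩
  obtain ⟨k14, hk14⟩ : ∃ f, f = K14 γp γw γx := ⟨_, rfl⟩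
  obtain ⟨k17, hk17⟩ : ∃ f, f = K17 γp γw γx := ⟨_, rfl⟩
  obtain ⟨c, hc⟩ : ∃ f, f = 1 + γp/(2*γw) := ⟨_, rfl⟩
  simp only [Sol9, ← hk2, ← hk5, ← hk6, ← hk9, ← hk10, ← hk11, ← hk13, ← hk16, ← hk7, ← hk14,
    ← hk17, ← hc]
  rw [← hk2] at c2
  rw [← hk5] at c5
  rw [← hk6] at c6
  rw [← hk9] at c9
  rw [← hk10] at c10
  rw [← hk11] at c11
  rw [← hk13] at c13
  rw [← hk16] at c16
  let a : Fin 6 → ℝ → ℝ := ![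
    fun t => -(Real.exp (-(r*t)) / 2 * k7 * k14),
    fun t => -(2 * k11 t + Real.exp (-(r*t)) / 2 * (2 * k5 t * k14 + 2 * k13 t * k7)),
    fun t => -(Real.exp (-(r*t)) / 2 * (2 * k6 t * k14 - 2 * γp * k2 t * k7)),
    fun t => -(4 * k9 t + Real.exp (-(r*t)) / 2 * (4 * k5 t * k13 t) - Real.exp (r*t) * (δ t)^2),
    fun t => -(4 * k10 t + Real.exp (-(r*t)) / 2 * (4 * k6 t * k13 t - 4 * γp * k5 t * k2 t)),
    fun t => Real.exp (-(r*t)) / 2 * (4 * γp * k6 t * k2 t)]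
  let b : Fin 6 → ℝ → ℝ := ![
    fun t => -(Real.exp (-(r*t)) / 2 * k17 * k14),
    fun t => -(Real.exp (-(r*t)) / 2 * (2 * k16 t * k14 + 2 * k13 t * k17)),
    fun t => -(2 * k11 t + Real.exp (-(r*t)) / 2 * (2 * c * k2 t * k14 - 2 * γp * k2 t * k17)),
    fun t => -(Real.exp (-(r*t)) / 2 * (4 * k16 t * k13 t)),
    fun t => -(4 * k9 t + Real.exp (-(r*t)) / 2 * (4 * c * k2 t * k13 t - 4 * γp * k16 t * k2 t)),
    fun t => -(4 * k10 t - Real.exp (-(r*t)) / 2 * (4 * γp * c * k2 t * k2 t)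
      - Real.exp (r*t) * (δ t)^2)]
  have ha : ∀ i, ContinuousOn (a i) (Set.Icc 0 T) := by
    intro i
    fin_cases i <;> simp [a] <;> fun_prop
  have hb : ∀ i, ContinuousOn (b i) (Set.Icc 0 T) := by
    intro i
    fin_cases i <;> simp [b] <;> fun_prop
  have ea : ∀ t x y, qd (fun i => a i t) x y =
      -(2 * x * (2 * k9 t * x + 2 * k10 t * y + k11 t)
          + (Real.exp (-(r*t)) / 2) * (2 * k5 t * x + 2 * k6 t * y + k7)
              * (2 * k13 t * x - 2 * γp * k2 t * y + k14)
          - Real.exp (r*t) * (δ t)^2 * x^2) := by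
    intro t x y
    simp only [qd, a, Matrix.cons_val]
    ring
  have eb : ∀ t x y, qd (fun i => b i t) x y =
      -(2 * y * (2 * k9 t * x + 2 * k10 t * y + k11 t)
          + (Real.exp (-(r*t)) / 2) * (2 * k16 t * x + 2 * c * k2 t * y + k17)
              * (2 * k13 t * x - 2 * γp * k2 t * y + k14)
          - Real.exp (r*t) * (δ t)^2 * y^2) := by
    intro t x y
    simp only [qd, b, Matrix.cons_val]
    ring
  clear_value a b
  obtain ⟨η, hη0, hηT, ⟨z, hz0, hz⟩, hu⟩ := quad_ode T hT a b ha hb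
  refine ⟨η, hη0, hηT, ?_, ?_⟩
  · refine ⟨fun t => (z t).1, fun t => (z t).2, by simp [hz0], by simp [hz0],
      fun t => (vf a b t (z t)).1, fun t => (vf a b t (z t)).2, fun t ht => ⟨?_, ?_, ?_, ?_⟩⟩
    · exact (hasFDerivAt_fst (𝕜 := ℝ)).comp_hasDerivWithinAt t (hz t ht)
    · exact (hasFDerivAt_snd (𝕜 := ℝ)).comp_hasDerivWithinAt t (hz t ht)
    · simp only [vf]
      rw [ea]; ring
    · simp only [vf]
      rw [eb]; ring
  · rintro P N Q W ⟨hP0, hN0, dP, dN, h1⟩ ⟨hQ0, hW0, dQ, dW, h2⟩ t ht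
    have := hu (fun t => (P t, N t)) (fun t => (Q t, W t)) (by simp [hP0, hN0])
      (by simp [hQ0, hW0]) ?_ ?_ t ht
    · exact ⟨congrArg Prod.fst this, congrArg Prod.snd this⟩
    · intro t ht
      obtain ⟨d1, d2, e1, e2⟩ := h1 t ht
      have : vf a b t (P t, N t) = (dP t, dN t) := by
        simp only [vf, ea, eb]
        ext <;> simp only <;> linarith
      rw [this]
      exact d1.prodMk d2
    · intro t ht
      obtain ⟨d1, d2, e1, e2⟩ := h2 t ht
      have : vf a b t (Q t, W t) = (dQ t, dW t) := by
        simp only [vf, ea, eb]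
        ext <;> simp only <;> linarith
      rw [this]
      exact d1.prodMk d2
end
end
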